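/- arXiv:1708.02442 — 3 statements merged into one kernel-verified Lean document; each statement's English description precedes it below -/
import Mathlib

section
/- Let K be an infinite field, u = (u_1,…,u_r) and x = (x_1,…,x_s) indeterminates, and M = [g_ij(u,x)] an m×n matrix (n ≤ m) with entries in K[u,x]. For a ∈ K^r let M_a = [g_ij(a,x)] ∈ Mat(m,n,K[x]). Then for generic a ∈ K^r and for all t ∈ {1,…,n}: if I_t(M_a) is a proper ideal of K[x], then I_t(M)^e is a proper ideal of K(u)[x] and height(I_t(M_a)) = height(I_t(M)^e). -/
set_option maxHeartbeats 1000000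
set_option synthInstance.maxHeartbeats 400000

/-- A subset of `ι → K` is Zariski open if it is the complement of the common zero
locus of a set of polynomials. -/
def ZariskiOpen {K : Type*} [CommRing K] {ι : Type*} (U : Set (ι → K)) : Prop :=
  ∃ S : Set (MvPolynomial ι K), U = { a | ∃ p ∈ S, MvPolynomial.eval a p ≠ 0 }

/-- `detIdeal t M` is the ideal `I_t(M)` generated by all `t × t` minors of `M`. -/
noncomputable def detIdeal {A : Type*} [CommRing A] {m n : ℕ} (t : ℕ)
    (M : Matrix (Fin m) (Fin n) A) : Ideal A :=
  Ideal.span { d | ∃ (f : Fin t → Fin m) (g : Fin t → Fin n), d = (M.submatrix f g).det }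

/-- The height of an ideal: the infimum of the heights of the primes containing it. -/
noncomputable def idealHeight {A : Type*} [CommRing A] (I : Ideal A) : ℕ∞ :=
  ⨅ (p : PrimeSpectrum A) (_ : I ≤ p.asIdeal), Order.height p

/-- The inclusion `K[u][x] → K(u)[x]`. -/
noncomputable def incKux (K : Type*) [Field K] (r s : ℕ) :
    MvPolynomial (Fin s) (MvPolynomial (Fin r) K) →+*
      MvPolynomial (Fin s) (FractionRing (MvPolynomial (Fin r) K)) :=
  MvPolynomial.map (algebraMap (MvPolynomial (Fin r) K) (FractionRing (MvPolynomial (Fin r) K)))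

/-- The substitution `K[u][x] → K[x]`, `u ↦ a`. -/
noncomputable def subKux {K : Type*} [Field K] {r s : ℕ} (a : Fin r → K) :
    MvPolynomial (Fin s) (MvPolynomial (Fin r) K) →+* MvPolynomial (Fin s) K :=
  MvPolynomial.map (MvPolynomial.eval a)

/-- The extension `J^e = J·K(u)[x]` of an ideal `J ⊆ K[u][x]`. -/
noncomputable def extIdeal {K : Type*} [Field K] {r s : ℕ}
    (J : Ideal (MvPolynomial (Fin s) (MvPolynomial (Fin r) K))) :
    Ideal (MvPolynomial (Fin s) (FractionRing (MvPolynomial (Fin r) K))) :=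
  Ideal.map (incKux K r s) J


theorem aux_height_max {k : Type*} [Field k] (n : ℕ) :
    ∀ (P : Ideal (MvPolynomial (Fin n) k)) [P.IsMaximal], P.height = n := by
  induction n with
  | zero =>
    intro P hP
    let e : MvPolynomial (Fin 0) k ≃+* k := (MvPolynomial.isEmptyAlgEquiv k (Fin 0)).toRingEquiv
    have hP' : (P.map e).IsMaximal := Ideal.map_isMaximal_of_equiv e
    rw [← e.height_map]
    have : P.map e = ⊥ := by
      rcases Ideal.eq_bot_or_top (P.map e) with h | h
      · exact h
      · exact absurd h hP'.ne_top
    rw [this]; simp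
  | succ n ih =>
    intro P hP
    let e : MvPolynomial (Fin (n+1)) k ≃+* Polynomial (MvPolynomial (Fin n) k) :=
      (MvPolynomial.finSuccEquiv k n).toRingEquiv
    have hP' : (P.map e).IsMaximal := Ideal.map_isMaximal_of_equiv e
    rw [← e.height_map]
    have h1 : ((P.map e).comap (Polynomial.C)).IsMaximal :=
      Polynomial.isMaximal_comap_C_of_isJacobsonRing (P.map e)
    have h2 : (P.map e).LiesOver ((P.map e).comap (Polynomial.C)) := ⟨rfl⟩
    rw [Polynomial.height_eq_height_add_one ((P.map e).comap (Polynomial.C)) (P.map e), ih]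
    simp

theorem aux_height_max' {k ι : Type*} [Field k] [Finite ι] (P : Ideal (MvPolynomial ι k))
    [P.IsMaximal] : P.height = Nat.card ι := by
  let e : MvPolynomial ι k ≃+* MvPolynomial (Fin (Nat.card ι)) k :=
    (MvPolynomial.renameEquiv k (Finite.equivFin ι)).toRingEquiv
  have hP' : (P.map e).IsMaximal := Ideal.map_isMaximal_of_equiv e
  rw [← e.height_map]
  exact aux_height_max _ _

theorem aux_isIntegral_of_X {R C ι : Type*} [CommRing R] [CommRing C]
    (J : Ideal (MvPolynomial ι R)) (θ : C →+* MvPolynomial ι R ⧸ J)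
    (h0 : ∀ r, θ.IsIntegralElem (Ideal.Quotient.mk J (MvPolynomial.C r)))
    (h1 : ∀ i, θ.IsIntegralElem (Ideal.Quotient.mk J (MvPolynomial.X i))) : θ.IsIntegral := by
  intro z
  obtain ⟨p, rfl⟩ := Ideal.Quotient.mk_surjective z
  induction p using MvPolynomial.induction_on with
  | C a => exact h0 a
  | add p q hp hq => rw [map_add]; exact RingHom.IsIntegralElem.add _ hp hq
  | mul_X p i hp => rw [map_mul]; exact RingHom.IsIntegralElem.mul _ hp (h1 i)

/-- trdeg bound -/
theorem aux_trdeg_le {k D : Type*} [Field k] [CommRing D] [IsDomain D] [Algebra k D] {d : ℕ}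
    (g : MvPolynomial (Fin d) k →ₐ[k] D) (hg : g.IsIntegral) : 
    ∃ t : Set D, t ⊆ Set.range (fun i => g (MvPolynomial.X i)) ∧
      IsTranscendenceBasis k ((↑) : t → D) := by
  have hr : Algebra.adjoin k (Set.range (fun i => g (MvPolynomial.X i))) = g.range := by
    rw [Algebra.adjoin_range_eq_range_aeval]
    congr 1
    ext; simp
  have : Algebra.IsAlgebraic (Algebra.adjoin k (Set.range (fun i => g (MvPolynomial.X i)))) D := by
    rw [hr]
    have : Algebra.IsIntegral g.range D := by
      constructor
      intro x
      obtain ⟨p, hp, hx⟩ := hg x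
      refine ⟨p.map g.rangeRestrict.toRingHom, hp.map _, ?_⟩
      rw [Polynomial.eval₂_map]
      exact hx
    infer_instance
  exact exists_isTranscendenceBasis_subset _
theorem aux_height_rel {A ι : Type*} [CommRing A] [IsDomain A] [Finite ι] [IsNoetherianRing A]
    (P : Ideal (MvPolynomial ι A)) [P.IsPrime]
    (h0 : ∀ c, MvPolynomial.C c ∈ P → c = 0)
    (h1 : ∀ i, ∃ q : Polynomial A, q ≠ 0 ∧ Polynomial.aeval (MvPolynomial.X i) q ∈ P) :
    P.height = Nat.card ι := by
  let F := FractionRing A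
  let S := (nonZeroDivisors A).map (MvPolynomial.C (σ := ι) (R := A))
  let : Algebra (MvPolynomial ι A) (MvPolynomial ι F) := MvPolynomial.algebraMvPolynomial
  have halg : algebraMap (MvPolynomial ι A) (MvPolynomial ι F) =
      MvPolynomial.map (algebraMap A F) := rfl
  have hloc : IsLocalization S (MvPolynomial ι F) := MvPolynomial.isLocalization _ _
  have hdisj : Disjoint (S : Set (MvPolynomial ι A)) (P : Set (MvPolynomial ι A)) := by
    rw [Set.disjoint_left]
    rintro _ ⟨c, hc, rfl⟩ hcP
    exact nonZeroDivisors.ne_zero hc (h0 c hcP)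
  let Q := P.map (algebraMap (MvPolynomial ι A) (MvPolynomial ι F))
  have hQ : Q.IsPrime := IsLocalization.isPrime_of_isPrime_disjoint S _ P ‹_› hdisj
  rw [← IsLocalization.height_map_of_disjoint (S := MvPolynomial ι F) S P hdisj]
  have hint : (algebraMap F (MvPolynomial ι F ⧸ Q)).IsIntegral := by
    apply aux_isIntegral_of_X
    · intro r
      exact RingHom.isIntegralElem_map _
    · intro i
      obtain ⟨q, hq, hqP⟩ := h1 i
      have : IsAlgebraic F (Ideal.Quotient.mk Q (MvPolynomial.X i)) := by
        refine ⟨q.map (algebraMap A F), ?_, ?_⟩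
        · rwa [Polynomial.map_ne_zero_iff (IsFractionRing.injective A F)]
        · have h2 : Ideal.Quotient.mk Q (algebraMap _ _ (Polynomial.aeval (MvPolynomial.X i) q)) = 0 :=
            Ideal.Quotient.eq_zero_iff_mem.2 (Ideal.mem_map_of_mem _ hqP)
          rw [← h2, Polynomial.aeval_def, Polynomial.aeval_def, Polynomial.eval₂_map,
            Polynomial.hom_eval₂, Polynomial.hom_eval₂]
          congr 1
          · ext a
            simp only [RingHom.comp_apply, halg, MvPolynomial.algebraMap_eq, MvPolynomial.map_C]
            rfl
          · rw [halg, MvPolynomial.map_X]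
      exact this.isIntegral
  have hmax : Q.IsMaximal := by
    apply Ideal.Quotient.maximal_of_isField
    have : Algebra.IsIntegral F (MvPolynomial ι F ⧸ Q) := ⟨hint⟩
    exact isField_of_isIntegral_of_isField' (R := F) (S := MvPolynomial ι F ⧸ Q) (Field.toIsField F)
  exact aux_height_max' Q

theorem aux_height_prime {k : Type*} [Field k] {s : ℕ} (P : Ideal (MvPolynomial (Fin s) k))
    [P.IsPrime] : ∃ e : ℕ, Algebra.trdeg k (MvPolynomial (Fin s) k ⧸ P) = e ∧
      P.height + e = s := by
  classical
  obtain ⟨t, ht, hbas⟩ := aux_trdeg_le (Ideal.Quotient.mkₐ k P)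
    (RingHom.isIntegral_of_surjective _ (Ideal.Quotient.mkₐ_surjective k P))
  choose f hf using fun a : t => ht a.2
  simp only [] at hf
  have hfinj : Function.Injective f := by
    intro a b hab
    apply Subtype.ext
    rw [← hf a, ← hf b, hab]
  let T : Set (Fin s) := Set.range f
  let v : T → MvPolynomial (Fin s) k ⧸ P := fun i => Ideal.Quotient.mkₐ k P (MvPolynomial.X i.1)
  have hv : IsTranscendenceBasis k v := by
    rw [← isTranscendenceBasis_equiv' (Equiv.ofInjective f hfinj) (f := v) (g := ((↑) : t → _))]
    · exact hbas
    · funext a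
      exact hf a
  refine ⟨Nat.card T, ?_, ?_⟩
  · have := hv.lift_cardinalMk_eq_trdeg
    have h2 : Cardinal.mk T = (Nat.card T : Cardinal) := Nat.cast_card.symm
    rw [h2, Cardinal.lift_natCast] at this
    simpa using this.symm
  · let σ : (Tᶜ : Set (Fin s)) ⊕ T ≃ Fin s := (Equiv.sumComm _ _).trans (Equiv.Set.sumCompl T)
    let e : MvPolynomial (Tᶜ : Set (Fin s)) (MvPolynomial T k) ≃ₐ[k] MvPolynomial (Fin s) k :=
      (MvPolynomial.sumAlgEquiv k _ _).symm.trans (MvPolynomial.renameEquiv k σ)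
    have heX : ∀ i : (Tᶜ : Set (Fin s)), e (MvPolynomial.X i) = MvPolynomial.X i.1 := by
      intro i
      have : MvPolynomial.sumAlgEquiv k (Tᶜ : Set (Fin s)) T (MvPolynomial.X (Sum.inl i)) = MvPolynomial.X i := by
        simp
      simp only [e, AlgEquiv.trans_apply]
      rw [← this, AlgEquiv.symm_apply_apply]
      simp [σ]
    have heC : ∀ i : T, e (MvPolynomial.C (MvPolynomial.X i)) = MvPolynomial.X i.1 := by
      intro i
      have : MvPolynomial.sumAlgEquiv k (Tᶜ : Set (Fin s)) T (MvPolynomial.X (Sum.inr i)) =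
          MvPolynomial.C (MvPolynomial.X i) := by
        simp
      simp only [e, AlgEquiv.trans_apply]
      rw [← this, AlgEquiv.symm_apply_apply]
      simp [σ]
    have hC : ∀ c : MvPolynomial T k, Ideal.Quotient.mk P (e (MvPolynomial.C c)) =
        MvPolynomial.aeval v c := by
      intro c
      have : ((Ideal.Quotient.mkₐ k P).comp (e : _ →ₐ[k] _)).comp
        (IsScalarTower.toAlgHom k (MvPolynomial T k) (MvPolynomial (Tᶜ : Set (Fin s)) (MvPolynomial T k)))
          = MvPolynomial.aeval v := by
        apply MvPolynomial.algHom_ext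
        intro i
        simp only [MvPolynomial.aeval_X, v]
        rw [← heC]
        rfl
      exact DFunLike.congr_fun this c
    have hpr : (P.comap e.toRingEquiv.toRingHom).IsPrime := Ideal.comap_isPrime _ _
    have hh : (P.comap e.toRingEquiv.toRingHom).height = P.height := RingEquiv.height_comap e.toRingEquiv P
    have key := aux_height_rel (P.comap e.toRingEquiv.toRingHom) ?_ ?_
    · rw [← hh, key]
      have := Nat.card_congr σ
      rw [Nat.card_sum] at this
      rw [Nat.card_fin] at this
      exact_mod_cast this
    · intro c hc
      have hc' : Ideal.Quotient.mk P (e (MvPolynomial.C c)) = 0 := Ideal.Quotient.eq_zero_iff_mem.2 hc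
      rw [hC] at hc'
      exact (injective_iff_map_eq_zero _).1 hv.1 c hc'
    · intro i
      have := hv.isAlgebraic.isAlgebraic (Ideal.Quotient.mk P (MvPolynomial.X i.1))
      obtain ⟨q, hq, hq0⟩ := this
      refine ⟨q.map (hv.1.aevalEquiv.symm : _ →+* _), ?_, ?_⟩
      · rwa [Polynomial.map_ne_zero_iff]
        exact hv.1.aevalEquiv.symm.injective
      · rw [Ideal.mem_comap, ← Ideal.Quotient.eq_zero_iff_mem, ← hq0, Polynomial.aeval_def,
          Polynomial.aeval_def, Polynomial.eval₂_map, Polynomial.hom_eval₂, Polynomial.hom_eval₂]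
        congr 1
        · ext c
          obtain ⟨c, rfl⟩ := hv.1.aevalEquiv.surjective c
          rw [AlgebraicIndependent.algebraMap_aevalEquiv, ← hC]
          simp [MvPolynomial.algebraMap_eq]
        · exact congrArg _ (heX i)

theorem aux_height_ideal {k : Type*} [Field k] {s d : ℕ} (I : Ideal (MvPolynomial (Fin s) k))
    (g : MvPolynomial (Fin d) k →ₐ[k] MvPolynomial (Fin s) k ⧸ I)
    (hinj : Function.Injective g) (hint : g.IsIntegral) : idealHeight I = ((s - d : ℕ) : ℕ∞) := by
  have upper : ∀ p : PrimeSpectrum (MvPolynomial (Fin s) k), I ≤ p.asIdeal →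
      ∃ e : ℕ, e ≤ d ∧ Algebra.trdeg k (MvPolynomial (Fin s) k ⧸ p.asIdeal) = e ∧
        Order.height p + e = s := by
    intro p hp
    obtain ⟨e, he, hh⟩ := aux_height_prime p.asIdeal
    refine ⟨e, ?_, he, ?_⟩
    · let π := Ideal.Quotient.factorₐ k hp
      have hπ : Function.Surjective π := Ideal.Quotient.factor_surjective hp
      obtain ⟨t, ht, hb⟩ := aux_trdeg_le (π.comp g)
        (RingHom.IsIntegral.trans _ _ hint (RingHom.isIntegral_of_surjective π.toRingHom hπ))
      have h1 := hb.lift_cardinalMk_eq_trdeg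
      rw [he] at h1
      have h2 : Cardinal.mk t = e := by simpa using h1
      have h3 : Cardinal.mk t ≤ Cardinal.mk (Set.range (fun i => (π.comp g) (MvPolynomial.X i))) :=
        Cardinal.mk_le_mk_of_subset ht
      have h4 := Cardinal.mk_range_le_lift (f := fun i => (π.comp g) (MvPolynomial.X i))
      have h5 := (Cardinal.lift_le.2 h3).trans h4
      rw [h2] at h5
      simpa using h5
    · rw [← PrimeSpectrum.height_eq_orderHeight]; exact hh
  have lower : ∃ p : PrimeSpectrum (MvPolynomial (Fin s) k), I ≤ p.asIdeal ∧
      ∃ e : ℕ, d ≤ e ∧ Algebra.trdeg k (MvPolynomial (Fin s) k ⧸ p.asIdeal) = e := by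
    let _ : Algebra (MvPolynomial (Fin d) k) (MvPolynomial (Fin s) k ⧸ I) := g.toRingHom.toAlgebra
    have : Algebra.IsIntegral (MvPolynomial (Fin d) k) (MvPolynomial (Fin s) k ⧸ I) := ⟨hint⟩
    obtain ⟨Q, -, hQ, hQ'⟩ := Ideal.exists_ideal_over_prime_of_isIntegral
      (⊥ : Ideal (MvPolynomial (Fin d) k)) (⊥ : Ideal (MvPolynomial (Fin s) k ⧸ I)) (by
        intro x hx
        have : g x = 0 := hx
        rw [Ideal.mem_bot]
        exact (injective_iff_map_eq_zero g).1 hinj x this)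
    let p : PrimeSpectrum (MvPolynomial (Fin s) k) :=
      ⟨Q.comap (Ideal.Quotient.mk I), Ideal.comap_isPrime _ _⟩
    have hIp : I ≤ p.asIdeal := by
      intro x hx
      change Ideal.Quotient.mk I x ∈ Q
      rw [Ideal.Quotient.eq_zero_iff_mem.2 hx]
      exact Q.zero_mem
    refine ⟨p, hIp, ?_⟩
    obtain ⟨e, -, he, -⟩ := upper p hIp
    refine ⟨e, ?_, he⟩
    let π := Ideal.Quotient.factorₐ k hIp
    have hi : AlgebraicIndependent k (fun i => (π.comp g) (MvPolynomial.X i)) := by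
      have h1 : MvPolynomial.aeval (fun i => (π.comp g) (MvPolynomial.X i)) = π.comp g := by
        ext; simp
      rw [AlgebraicIndependent, h1, injective_iff_map_eq_zero]
      intro x hx
      have h2 : x ∈ Q.comap (algebraMap (MvPolynomial (Fin d) k) (MvPolynomial (Fin s) k ⧸ I)) := by
        change g x ∈ Q
        obtain ⟨y, hy⟩ := Ideal.Quotient.mk_surjective (g x)
        have h3 : π (g x) = 0 := hx
        rw [← hy] at h3 ⊢
        exact (Ideal.Quotient.eq_zero_iff_mem (I := p.asIdeal)).1 h3
      rwa [hQ', Ideal.mem_bot] at h2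
    have := hi.lift_cardinalMk_le_trdeg
    rw [he] at this
    simpa using this
  obtain ⟨p, hIp, e, hde, he⟩ := lower
  obtain ⟨e', hd', he', hh⟩ := upper p hIp
  have : e = e' := by rw [he] at he'; exact_mod_cast he'
  subst this
  have : e = d := le_antisymm hd' hde
  subst this
  apply le_antisymm
  · refine (iInf₂_le p hIp).trans ?_
    have hne : Order.height p ≠ ⊤ := by
      intro h
      rw [h] at hh
      simp at hh
    obtain ⟨n, hn⟩ := ENat.ne_top_iff_exists.1 hne
    rw [← hn] at hh ⊢
    norm_cast at hh ⊢
    omega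
  · refine le_iInf₂ fun q hq => ?_
    obtain ⟨e', hd', -, hh⟩ := upper q hq
    have hne : Order.height q ≠ ⊤ := by
      intro h
      rw [h] at hh
      simp at hh
    obtain ⟨n, hn⟩ := ENat.ne_top_iff_exists.1 hne
    rw [← hn] at hh ⊢
    norm_cast at hh ⊢
    omega

theorem aux_specialize {A k : Type*} [CommRing A] [Field k] {s d : ℕ} (ev : A →+* k)
    (hev : Function.Surjective ev) (J : Ideal (MvPolynomial (Fin s) A))
    (θ : MvPolynomial (Fin d) A →+* MvPolynomial (Fin s) A ⧸ J)
    (hC : ∀ r, θ (MvPolynomial.C r) = Ideal.Quotient.mk J (MvPolynomial.C r))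
    (hinj : Function.Injective θ) (hint : θ.IsIntegral) :
    ∃ g : MvPolynomial (Fin d) k →ₐ[k] MvPolynomial (Fin s) k ⧸ (J.map (MvPolynomial.map ev)),
      Function.Injective g ∧ g.IsIntegral := by
  choose G hG using fun i => Ideal.Quotient.mk_surjective (θ (MvPolynomial.X i))
  let Jk := J.map (MvPolynomial.map (σ := Fin s) ev)
  let q : MvPolynomial (Fin s) A ⧸ J →+* MvPolynomial (Fin s) k ⧸ Jk :=
    Ideal.quotientMap Jk (MvPolynomial.map ev) Ideal.le_comap_map
  have hqs : Function.Surjective q :=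
    Ideal.quotientMap_surjective (MvPolynomial.map_surjective ev hev)
  let g : MvPolynomial (Fin d) k →ₐ[k] MvPolynomial (Fin s) k ⧸ Jk :=
    MvPolynomial.aeval (fun i => Ideal.Quotient.mk Jk (MvPolynomial.map ev (G i)))
  have hcomp : g.toRingHom.comp (MvPolynomial.map ev) = q.comp θ := by
    apply MvPolynomial.ringHom_ext
    · intro r
      simp only [RingHom.comp_apply, hC, MvPolynomial.map_C]
      change g (MvPolynomial.C (ev r)) = Ideal.Quotient.mk Jk (MvPolynomial.map ev (MvPolynomial.C r))
      rw [MvPolynomial.map_C]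
      simp only [g, MvPolynomial.aeval_C]
      rfl
    · intro i
      simp only [RingHom.comp_apply, ← hG, MvPolynomial.map_X]
      change g (MvPolynomial.X i) = Ideal.Quotient.mk Jk (MvPolynomial.map ev (G i))
      simp [g]
  refine ⟨g, ?_, ?_⟩
  · rw [injective_iff_map_eq_zero]
    intro h hh
    obtain ⟨h, rfl⟩ := MvPolynomial.map_surjective ev hev h
    let _ : Algebra (MvPolynomial (Fin d) A) (MvPolynomial (Fin s) A ⧸ J) := θ.toAlgebra
    have : Algebra.IsIntegral (MvPolynomial (Fin d) A) (MvPolynomial (Fin s) A ⧸ J) := ⟨hint⟩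
    let Q0 : Ideal (MvPolynomial (Fin d) A) := RingHom.ker (MvPolynomial.map (σ := Fin d) ev)
    have hQ0 : Q0.IsPrime := RingHom.ker_isPrime _
    obtain ⟨Q, -, hQ, hQ'⟩ := Ideal.exists_ideal_over_prime_of_isIntegral
      Q0 (⊥ : Ideal (MvPolynomial (Fin s) A ⧸ J)) (by
        intro x hx
        have h0 : θ x = 0 := hx
        rw [(injective_iff_map_eq_zero θ).1 hinj x h0]
        exact Q0.zero_mem)
    have hconst : ∀ r : A, ev r = 0 → Ideal.Quotient.mk J (MvPolynomial.C r) ∈ Q := by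
      intro r hr
      rw [← hC]
      change (MvPolynomial.C r : MvPolynomial (Fin d) A) ∈ Q.comap
        (algebraMap (MvPolynomial (Fin d) A) (MvPolynomial (Fin s) A ⧸ J))
      rw [hQ', RingHom.mem_ker, MvPolynomial.map_C, hr, map_zero]
    have hker : RingHom.ker q ≤ Q := by
      intro z hz
      obtain ⟨z, rfl⟩ := Ideal.Quotient.mk_surjective z
      have hz1 : MvPolynomial.map ev z ∈ Jk := by
        rw [← Ideal.Quotient.eq_zero_iff_mem]; exact hz
      have hz2 := (Ideal.mem_map_iff_of_surjective _ (MvPolynomial.map_surjective ev hev)).1 hz1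
      obtain ⟨w, hw, hwz⟩ := hz2
      have h3 : z - w ∈ Q.comap (Ideal.Quotient.mk J) := by
        have h4 : z - w ∈ RingHom.ker (MvPolynomial.map (σ := Fin s) ev) := by
          rw [RingHom.mem_ker, map_sub, hwz, sub_self]
        rw [MvPolynomial.ker_map] at h4
        refine (Ideal.map_le_iff_le_comap.2 ?_) h4
        intro r hr
        exact hconst r hr
      rw [Ideal.mem_comap, map_sub, Ideal.Quotient.eq_zero_iff_mem.2 hw, sub_zero] at h3
      exact h3
    have h5 : θ h ∈ Q := by
      apply hker
      rw [RingHom.mem_ker]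
      have := DFunLike.congr_fun hcomp h
      exact this.symm.trans hh
    have h6 : h ∈ Q0 := by rw [← hQ']; exact h5
    exact h6
  · have h1 : (g.toRingHom.comp (MvPolynomial.map ev)).IsIntegral := by
      rw [hcomp]
      exact RingHom.IsIntegral.trans _ _ hint (RingHom.isIntegral_of_surjective q hqs)
    exact RingHom.IsIntegral.tower_top _ _ h1

theorem aux_noether {A : Type*} [CommRing A] [IsDomain A] {s : ℕ}
    (I : Ideal (MvPolynomial (Fin s) (FractionRing A))) (hI : I ≠ ⊤) :
    ∃ (d : ℕ) (G : Fin d → MvPolynomial (Fin s) A)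
      (g : MvPolynomial (Fin d) (FractionRing A) →ₐ[FractionRing A]
        MvPolynomial (Fin s) (FractionRing A) ⧸ I),
      Function.Injective g ∧ g.IsIntegral ∧ ∀ i, g (MvPolynomial.X i) =
        Ideal.Quotient.mk I (MvPolynomial.map (algebraMap A (FractionRing A)) (G i)) := by
  obtain ⟨d, -, g, hinj, hint⟩ := exists_integral_inj_algHom_of_quotient I hI
  choose H hH using fun i => Ideal.Quotient.mk_surjective (g (MvPolynomial.X i))
  let F := FractionRing A
  let S := (nonZeroDivisors A).map (MvPolynomial.C (σ := Fin s) (R := A))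
  let _ : Algebra (MvPolynomial (Fin s) A) (MvPolynomial (Fin s) F) := MvPolynomial.algebraMvPolynomial
  have hloc : IsLocalization S (MvPolynomial (Fin s) F) := MvPolynomial.isLocalization _ _
  obtain ⟨⟨_, c, hc, rfl⟩, hb⟩ := IsLocalization.exist_integer_multiples_of_finite S H
  choose G hG using hb
  have hG' : ∀ i, MvPolynomial.map (algebraMap A F) (G i) =
      MvPolynomial.C (algebraMap A F c) * H i := by
    intro i
    have h1 := hG i
    rw [Algebra.smul_def] at h1
    refine h1.trans ?_
    congr 1
    exact MvPolynomial.map_C _ _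
  have hc0 : algebraMap A F c ≠ 0 := by
    have := nonZeroDivisors.ne_zero hc
    simpa using this
  let φ : MvPolynomial (Fin d) F ≃ₐ[F] MvPolynomial (Fin d) F := AlgEquiv.ofAlgHom
    (MvPolynomial.aeval (fun i => MvPolynomial.C (algebraMap A F c) * MvPolynomial.X i))
    (MvPolynomial.aeval (fun i => MvPolynomial.C (algebraMap A F c)⁻¹ * MvPolynomial.X i))
    (by
      apply MvPolynomial.algHom_ext
      intro i
      simp only [AlgHom.comp_apply, MvPolynomial.aeval_X, map_mul, MvPolynomial.aeval_C,
        MvPolynomial.algebraMap_eq, AlgHom.id_apply]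
      rw [← mul_assoc, ← map_mul, inv_mul_cancel₀ hc0, map_one, one_mul])
    (by
      apply MvPolynomial.algHom_ext
      intro i
      simp only [AlgHom.comp_apply, MvPolynomial.aeval_X, map_mul, MvPolynomial.aeval_C,
        MvPolynomial.algebraMap_eq, AlgHom.id_apply]
      rw [← mul_assoc, ← map_mul, mul_inv_cancel₀ hc0, map_one, one_mul])
  refine ⟨d, G, g.comp φ.toAlgHom, hinj.comp φ.injective, ?_, ?_⟩
  · exact RingHom.IsIntegral.trans φ.toAlgHom.toRingHom g.toRingHom
      (RingHom.isIntegral_of_surjective _ φ.surjective) hint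
  · intro i
    rw [hG', map_mul, hH]
    have : φ (MvPolynomial.X i) = MvPolynomial.C (algebraMap A F c) * MvPolynomial.X i := by
      simp [φ]
    change g (φ (MvPolynomial.X i)) = _
    rw [this, map_mul]
    congr 1
    exact g.commutes _

theorem aux_mem_ext {A : Type*} [CommRing A] [IsDomain A] {s : ℕ}
    (J : Ideal (MvPolynomial (Fin s) A)) (p : MvPolynomial (Fin s) A)
    (hp : MvPolynomial.map (algebraMap A (FractionRing A)) p ∈
      J.map (MvPolynomial.map (algebraMap A (FractionRing A)))) :
    ∃ m : A, m ≠ 0 ∧ MvPolynomial.C m * p ∈ J := by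
  let F := FractionRing A
  let S := (nonZeroDivisors A).map (MvPolynomial.C (σ := Fin s) (R := A))
  let _ : Algebra (MvPolynomial (Fin s) A) (MvPolynomial (Fin s) F) := MvPolynomial.algebraMvPolynomial
  have hloc : IsLocalization S (MvPolynomial (Fin s) F) := MvPolynomial.isLocalization _ _
  have h := (IsLocalization.algebraMap_mem_map_algebraMap_iff S (MvPolynomial (Fin s) F) J p).1 hp
  obtain ⟨_, ⟨m, hm, rfl⟩, h⟩ := h
  exact ⟨m, nonZeroDivisors.ne_zero hm, h⟩

theorem aux_integral_mult {A : Type*} [CommRing A] [IsDomain A] {d : ℕ} {E : Type*} [CommRing E]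
    (g : MvPolynomial (Fin d) (FractionRing A) →+* E) (hint : g.IsIntegral) (z : E) :
    ∃ c : A, c ≠ 0 ∧ ∃ p : Polynomial (MvPolynomial (Fin d) A), p.Monic ∧
      p.eval₂ (g.comp (MvPolynomial.map (algebraMap A (FractionRing A))))
        (g (MvPolynomial.C (algebraMap A (FractionRing A) c)) * z) = 0 := by
  let F := FractionRing A
  let S := (nonZeroDivisors A).map (MvPolynomial.C (σ := Fin d) (R := A))
  let _ : Algebra (MvPolynomial (Fin d) A) (MvPolynomial (Fin d) F) := MvPolynomial.algebraMvPolynomial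
  have hloc : IsLocalization S (MvPolynomial (Fin d) F) := MvPolynomial.isLocalization _ _
  let _ : Algebra (MvPolynomial (Fin d) F) E := g.toAlgebra
  let _ : Algebra (MvPolynomial (Fin d) A) E :=
    (g.comp (MvPolynomial.map (algebraMap A F))).toAlgebra
  have : IsScalarTower (MvPolynomial (Fin d) A) (MvPolynomial (Fin d) F) E :=
    IsScalarTower.of_algebraMap_eq fun _ => rfl
  have hz : IsIntegral (MvPolynomial (Fin d) F) z := hint z
  obtain ⟨⟨_, c, hc, rfl⟩, p, hp, hp0⟩ := hz.exists_multiple_integral_of_isLocalization S z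
  refine ⟨c, nonZeroDivisors.ne_zero hc, p, hp, ?_⟩
  have h1 : g (MvPolynomial.C (algebraMap A F c)) * z =
      (MvPolynomial.C c : MvPolynomial (Fin d) A) • z := by
    rw [Algebra.smul_def]
    congr 1
    change _ = g (MvPolynomial.map (algebraMap A F) (MvPolynomial.C c))
    rw [MvPolynomial.map_C]
  rw [h1]
  exact hp0

theorem aux_spread {A : Type*} [CommRing A] [IsDomain A] {s : ℕ}
    (J : Ideal (MvPolynomial (Fin s) A))
    (hJ : J.map (MvPolynomial.map (algebraMap A (FractionRing A))) ≠ ⊤) :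
    ∃ (d : ℕ) (f : A) (_ : f ≠ 0)
      (g : MvPolynomial (Fin d) (FractionRing A) →ₐ[FractionRing A]
        MvPolynomial (Fin s) (FractionRing A) ⧸
          J.map (MvPolynomial.map (algebraMap A (FractionRing A))))
      (θ : MvPolynomial (Fin d) (Localization.Away f) →+*
        MvPolynomial (Fin s) (Localization.Away f) ⧸
          J.map (MvPolynomial.map (algebraMap A (Localization.Away f)))),
      Function.Injective g ∧ g.IsIntegral ∧
      (∀ r, θ (MvPolynomial.C r) = Ideal.Quotient.mk _ (MvPolynomial.C r)) ∧
      Function.Injective θ ∧ θ.IsIntegral := by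
  obtain ⟨d, G, g, hinj, hint, hG⟩ := aux_noether _ hJ
  let F := FractionRing A
  let inc : MvPolynomial (Fin s) A →+* MvPolynomial (Fin s) F := MvPolynomial.map (algebraMap A F)
  let Je := J.map inc
  let θ0 : MvPolynomial (Fin d) A →+* MvPolynomial (Fin s) A :=
    (MvPolynomial.aeval G : MvPolynomial (Fin d) A →ₐ[A] _).toRingHom
  have hθ0 : ((Ideal.Quotient.mk Je).comp inc).comp θ0 =
      g.toRingHom.comp (MvPolynomial.map (algebraMap A F)) := by
    apply MvPolynomial.ringHom_ext
    · intro r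
      have h1 : θ0 (MvPolynomial.C r) = MvPolynomial.C r := by
        simp [θ0, MvPolynomial.algebraMap_eq]
      rw [RingHom.comp_apply, RingHom.comp_apply, RingHom.comp_apply, h1]
      simp only [inc, MvPolynomial.map_C]
      exact (g.commutes _).symm
    · intro i
      have h1 : θ0 (MvPolynomial.X i) = G i := by simp [θ0]
      rw [RingHom.comp_apply, RingHom.comp_apply, RingHom.comp_apply, h1, MvPolynomial.map_X]
      exact (hG i).symm
  have key : ∀ j : Fin s, ∃ c m : A, c ≠ 0 ∧ m ≠ 0 ∧
      ∃ p : Polynomial (MvPolynomial (Fin d) A), p.Monic ∧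
        MvPolynomial.C m * p.eval₂ θ0 (MvPolynomial.C c * MvPolynomial.X j) ∈ J := by
    intro j
    obtain ⟨c, hc, p, hp, hp0⟩ := aux_integral_mult g.toRingHom hint
      (Ideal.Quotient.mk Je (MvPolynomial.X j))
    obtain ⟨m, hm, hmem⟩ := aux_mem_ext J (p.eval₂ θ0 (MvPolynomial.C c * MvPolynomial.X j)) (by
      rw [← Ideal.Quotient.eq_zero_iff_mem]
      change ((Ideal.Quotient.mk Je).comp inc) _ = 0
      rw [Polynomial.hom_eval₂, hθ0]
      rw [← hp0]
      congr 1
      rw [map_mul]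
      congr 1
      · simp only [RingHom.comp_apply, inc, MvPolynomial.map_C]
        exact (g.commutes _).symm
      · simp only [RingHom.comp_apply, inc, MvPolynomial.map_X])
    exact ⟨c, m, hc, hm, p, hp, hmem⟩
  choose c m hc hm p hp hmem using key
  let f : A := ∏ j, (c j * m j)
  have hf : f ≠ 0 := Finset.prod_ne_zero_iff.2 fun j _ => mul_ne_zero (hc j) (hm j)
  let Af := Localization.Away f
  have hfu : IsUnit (algebraMap A Af f) := IsLocalization.Away.algebraMap_isUnit f
  have hcu : ∀ j, IsUnit (algebraMap A Af (c j * m j)) := fun j =>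
    isUnit_of_dvd_unit (map_dvd _ (Finset.dvd_prod_of_mem (fun j => c j * m j) (Finset.mem_univ j))) hfu
  let incf : MvPolynomial (Fin s) A →+* MvPolynomial (Fin s) Af := MvPolynomial.map (algebraMap A Af)
  let J' := J.map incf
  obtain ⟨θ, hθC, hθX⟩ : ∃ θ : MvPolynomial (Fin d) Af →+* MvPolynomial (Fin s) Af ⧸ J',
      (∀ r, θ (MvPolynomial.C r) = Ideal.Quotient.mk J' (MvPolynomial.C r)) ∧
      (∀ i, θ (MvPolynomial.X i) = Ideal.Quotient.mk J' (incf (G i))) := by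
    refine ⟨(Ideal.Quotient.mk J').comp
      (MvPolynomial.aeval (fun i => incf (G i)) : MvPolynomial (Fin d) Af →ₐ[Af] _).toRingHom,
      fun r => ?_, fun i => ?_⟩
    · simp [MvPolynomial.algebraMap_eq]
    · simp
  have hθ : ((Ideal.Quotient.mk J').comp incf).comp θ0 =
      θ.comp (MvPolynomial.map (algebraMap A Af)) := by
    apply MvPolynomial.ringHom_ext
    · intro r
      have h1 : θ0 (MvPolynomial.C r) = MvPolynomial.C r := by
        simp [θ0, MvPolynomial.algebraMap_eq]
      rw [RingHom.comp_apply, RingHom.comp_apply, RingHom.comp_apply, h1]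
      simp only [incf, MvPolynomial.map_C]
      rw [hθC]
    · intro i
      have h1 : θ0 (MvPolynomial.X i) = G i := by simp [θ0]
      rw [RingHom.comp_apply, RingHom.comp_apply, RingHom.comp_apply, h1, MvPolynomial.map_X, hθX]
  refine ⟨d, f, hf, g, θ, hinj, hint, hθC, ?_, ?_⟩
  · have hle : Submonoid.powers f ≤ nonZeroDivisors A :=
      powers_le_nonZeroDivisors_of_noZeroDivisors hf
    let ι : Af →+* F := IsLocalization.Away.lift f (g := algebraMap A F)
      (isUnit_iff_ne_zero.2 (by simpa using hf))
    have hι : ι.comp (algebraMap A Af) = algebraMap A F := IsLocalization.Away.lift_comp _ _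
    have hιinj : Function.Injective ι := by
      refine (IsLocalization.lift_injective_iff (M := Submonoid.powers f) _).2 ?_
      intro x y
      rw [(IsLocalization.injective Af hle).eq_iff,
        (IsFractionRing.injective A F).eq_iff]
    have hmap : J'.map (MvPolynomial.map ι) = Je := by
      simp only [J', Je, Ideal.map_map]
      congr 1
      simp only [incf, inc]
      rw [← hι]
      exact (RingHom.ext fun x => MvPolynomial.map_map _ _ x)
    let q : MvPolynomial (Fin s) Af ⧸ J' →+* MvPolynomial (Fin s) F ⧸ Je :=
      Ideal.quotientMap Je (MvPolynomial.map ι) (by rw [← hmap]; exact Ideal.le_comap_map)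
    have hq : q.comp θ = g.toRingHom.comp (MvPolynomial.map ι) := by
      apply MvPolynomial.ringHom_ext
      · intro r
        rw [RingHom.comp_apply, RingHom.comp_apply, hθC, MvPolynomial.map_C]
        change Ideal.Quotient.mk Je (MvPolynomial.map ι (MvPolynomial.C r)) = _
        rw [MvPolynomial.map_C]
        exact (g.commutes _).symm
      · intro i
        rw [RingHom.comp_apply, RingHom.comp_apply, hθX, MvPolynomial.map_X]
        change Ideal.Quotient.mk Je (MvPolynomial.map ι (incf (G i))) = g (MvPolynomial.X i)
        rw [hG]
        simp only [incf]
        rw [MvPolynomial.map_map, hι]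
    have h2 : Function.Injective (q.comp θ) := by
      rw [hq]
      exact hinj.comp (MvPolynomial.map_injective ι hιinj)
    rw [RingHom.coe_comp] at h2
    exact Function.Injective.of_comp h2
  · apply aux_isIntegral_of_X
    · intro r
      rw [← hθC]
      exact θ.isIntegralElem_map
    · intro j
      have hu := hcu j
      rw [map_mul] at hu
      have h1 : θ.IsIntegralElem (Ideal.Quotient.mk J' (incf (MvPolynomial.C (c j) * MvPolynomial.X j))) := by
        refine ⟨(p j).map (MvPolynomial.map (algebraMap A Af)), (hp j).map _, ?_⟩
        rw [Polynomial.eval₂_map, ← hθ]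
        have h2 : Ideal.Quotient.mk J' (incf (MvPolynomial.C (m j) *
            (p j).eval₂ θ0 (MvPolynomial.C (c j) * MvPolynomial.X j))) = 0 :=
          Ideal.Quotient.eq_zero_iff_mem.2 (Ideal.mem_map_of_mem _ (hmem j))
        rw [map_mul, map_mul] at h2
        have hmu : IsUnit (Ideal.Quotient.mk J' (incf (MvPolynomial.C (m j)))) := by
          simp only [incf, MvPolynomial.map_C]
          exact ((isUnit_of_mul_isUnit_right hu).map MvPolynomial.C).map _
        rw [hmu.mul_right_eq_zero] at h2
        rw [← h2]
        exact (Polynomial.hom_eval₂ _ _ ((Ideal.Quotient.mk J').comp incf) _).symm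
      obtain ⟨v, hv⟩ := isUnit_of_mul_isUnit_left hu
      have h3 : Ideal.Quotient.mk J' (MvPolynomial.X j) =
          θ (MvPolynomial.C (↑v⁻¹ : Af)) *
          Ideal.Quotient.mk J' (incf (MvPolynomial.C (c j) * MvPolynomial.X j)) := by
        rw [hθC, ← map_mul]
        congr 1
        simp only [incf, map_mul, MvPolynomial.map_C, MvPolynomial.map_X]
        rw [← mul_assoc, ← map_mul, ← hv, Units.inv_mul, map_one, one_mul]
      rw [h3]
      exact RingHom.IsIntegralElem.mul _ θ.isIntegralElem_map h1

theorem aux_main {K : Type*} [Field K] {r s : ℕ}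
    (J : Ideal (MvPolynomial (Fin s) (MvPolynomial (Fin r) K))) :
    ∃ f : MvPolynomial (Fin r) K, f ≠ 0 ∧ ∀ a : Fin r → K, MvPolynomial.eval a f ≠ 0 →
      J.map (subKux a) ≠ ⊤ →
        extIdeal J ≠ ⊤ ∧ idealHeight (J.map (subKux a)) = idealHeight (extIdeal J) := by
  by_cases hJ : extIdeal J = ⊤
  · obtain ⟨m, hm, hmem⟩ := aux_mem_ext J 1 (by
      change _ ∈ extIdeal J
      rw [hJ]; trivial)
    refine ⟨m, hm, fun a ha hne => absurd ?_ hne⟩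
    have h1 := Ideal.mem_map_of_mem (subKux a) hmem
    rw [mul_one] at h1
    refine Ideal.eq_top_of_isUnit_mem _ h1 ?_
    simp only [subKux, MvPolynomial.map_C]
    exact (isUnit_iff_ne_zero.2 ha).map MvPolynomial.C
  · obtain ⟨d, f, hf, g, θ, hgi, hgint, hC, hinj, hint⟩ := aux_spread J hJ
    refine ⟨f, hf, fun a ha _ => ⟨hJ, ?_⟩⟩
    let ev : Localization.Away f →+* K := IsLocalization.Away.lift f
      (g := MvPolynomial.eval a) (isUnit_iff_ne_zero.2 ha)
    have hev : ev.comp (algebraMap _ _) = MvPolynomial.eval a := IsLocalization.Away.lift_comp _ _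
    have hsurj : Function.Surjective ev := by
      intro k
      refine ⟨algebraMap (MvPolynomial (Fin r) K) _ (MvPolynomial.C k), ?_⟩
      have := DFunLike.congr_fun hev (MvPolynomial.C k)
      rw [RingHom.comp_apply] at this
      rw [this, MvPolynomial.eval_C]
    obtain ⟨g', hg', hg'int⟩ := aux_specialize ev hsurj _ θ hC hinj hint
    have hmap : (J.map (MvPolynomial.map (algebraMap _ (Localization.Away f)))).map
        (MvPolynomial.map ev) = J.map (subKux a) := by
      rw [Ideal.map_map]
      congr 1
      rw [subKux, ← hev]
      exact (RingHom.ext fun x => MvPolynomial.map_map _ _ x)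
    have h1 := aux_height_ideal _ g' hg' hg'int
    have h2 := aux_height_ideal _ g hgi hgint
    rw [hmap] at h1
    exact h1.trans h2.symm

theorem aux_detIdeal_map {A B : Type*} [CommRing A] [CommRing B] {m n : ℕ} (t : ℕ)
    (M : Matrix (Fin m) (Fin n) A) (φ : A →+* B) :
    detIdeal t (M.map φ) = (detIdeal t M).map φ := by
  rw [detIdeal, detIdeal, Ideal.map_span]
  congr 1
  ext x
  constructor
  · rintro ⟨f, g, rfl⟩
    exact ⟨_, ⟨f, g, rfl⟩, RingHom.map_det φ _⟩
  · rintro ⟨_, ⟨f, g, rfl⟩, rfl⟩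
    exact ⟨f, g, RingHom.map_det φ _⟩

/-- For an `m × n` matrix `M` (`n ≤ m`) with entries in `K[u][x]`, `K` infinite, and
for generic `a ∈ K^r` and all `t = 1, …, n`: if `I_t(M_a)` is proper, then `I_t(M)^e`
is proper and `height I_t(M_a) = height (I_t(M)^e)`. -/
theorem height_specialization_detIdeal
    {K : Type*} [Field K] [Infinite K] {r s m n : ℕ} (hnm : n ≤ m)
    (M : Matrix (Fin m) (Fin n) (MvPolynomial (Fin s) (MvPolynomial (Fin r) K))) :
    ∃ U : Set (Fin r → K), ZariskiOpen U ∧ U.Nonempty ∧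
      ∀ a ∈ U, ∀ t : ℕ, 1 ≤ t → t ≤ n →
        detIdeal t (M.map (subKux a)) ≠ ⊤ →
          extIdeal (detIdeal t M) ≠ ⊤ ∧
            idealHeight (detIdeal t (M.map (subKux a))) = idealHeight (extIdeal (detIdeal t M)) := by
  choose f hf0 hf using fun t : ℕ => aux_main (detIdeal t M)
  let h : MvPolynomial (Fin r) K := ∏ t ∈ Finset.range (n + 1), f t
  have hh : h ≠ 0 := Finset.prod_ne_zero_iff.2 fun t _ => hf0 t
  refine ⟨{a | MvPolynomial.eval a h ≠ 0}, ⟨{h}, by simp⟩, ?_, ?_⟩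
  · by_contra hne
    apply hh
    apply MvPolynomial.funext
    intro a
    rw [map_zero]
    by_contra ha
    exact hne ⟨a, ha⟩
  · intro a ha t _ ht hprop
    have hat : MvPolynomial.eval a (f t) ≠ 0 := by
      have ha' : MvPolynomial.eval a h ≠ 0 := ha
      simp only [h, map_prod] at ha'
      exact Finset.prod_ne_zero_iff.1 ha' t (Finset.mem_range.2 (Nat.lt_succ_of_le ht))
    rw [aux_detIdeal_map] at hprop ⊢
    exact hf t a hat hprop
end

section
/- Let I and J be proper ideals of R = K[[x_1,…,x_s]], given by generating lists of the same length m, and let A, B ∈ Mat(m,1,R) be the corresponding column matrices of generators. Then the following are equivalent: (1) I and J are contact equivalent (R/I ≅ R/J as local K-algebras); (2) there is a local K-algebra automorphism φ of R with φ(I) = J; (3) there exist a local K-algebra automorphism φ of R and U ∈ GL(m,R) with B = U·φ(A); (4) A and B are G-equivalent. Moreover, if m equals the minimal number of generators of I, then I is contact k-determined if and only if A is G k-determined. -/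
noncomputable section

/-- The maximal ideal `𝔪 = ⟨x_1,…,x_s⟩` of `R = K[[x_1,…,x_s]]`. -/
def mIdeal (s : ℕ) (K : Type*) [Field K] : Ideal (MvPowerSeries (Fin s) K) :=
  Ideal.span (Set.range MvPowerSeries.X)

/-- Left-right (`G`-) equivalence of matrices over `R = K[[x_1,…,x_s]]`:
`B = U · φ(A) · V` for invertible `U`, `V` and a (local) `K`-algebra
automorphism `φ` of `R` applied entrywise. -/
def GEquiv {s : ℕ} {K : Type*} [Field K] {m n : ℕ}
    (A B : Matrix (Fin m) (Fin n) (MvPowerSeries (Fin s) K)) : Prop :=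
  ∃ (U : Matrix (Fin m) (Fin m) (MvPowerSeries (Fin s) K))
    (V : Matrix (Fin n) (Fin n) (MvPowerSeries (Fin s) K))
    (φ : MvPowerSeries (Fin s) K ≃ₐ[K] MvPowerSeries (Fin s) K),
    IsUnit U ∧ IsUnit V ∧ B = U * (A.map φ) * V

/-- A matrix `A` is `G` `k`-determined if every `B` with `B - A ∈ 𝔪^{k+1}·M_{m,n}`
is `G`-equivalent to `A`. -/
def GDetermined {s : ℕ} {K : Type*} [Field K] {m n : ℕ} (k : ℕ)
    (A : Matrix (Fin m) (Fin n) (MvPowerSeries (Fin s) K)) : Prop :=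
  ∀ B : Matrix (Fin m) (Fin n) (MvPowerSeries (Fin s) K),
    (∀ i j, B i j - A i j ∈ (mIdeal s K) ^ (k + 1)) → GEquiv A B

/-- A matrix is finitely `G`-determined if it is `G` `k`-determined for some `k`. -/
def FinitelyGDetermined {s : ℕ} {K : Type*} [Field K] {m n : ℕ}
    (A : Matrix (Fin m) (Fin n) (MvPowerSeries (Fin s) K)) : Prop :=
  ∃ k : ℕ, GDetermined k A

end

noncomputable section

/-- Two ideals `I`, `J` of `R = K[[x_1,…,x_s]]` are contact equivalent if the local
`K`-algebras `R/I` and `R/J` are isomorphic. -/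
def ContactEquiv {s : ℕ} {K : Type*} [Field K] (I J : Ideal (MvPowerSeries (Fin s) K)) : Prop :=
  Nonempty ((MvPowerSeries (Fin s) K ⧸ I) ≃ₐ[K] (MvPowerSeries (Fin s) K ⧸ J))

/-- `a_1,…,a_m` is a minimal set of generators of the ideal `I`. -/
def IsMinGenSys {s : ℕ} {K : Type*} [Field K] {m : ℕ}
    (a : Fin m → MvPowerSeries (Fin s) K) (I : Ideal (MvPowerSeries (Fin s) K)) : Prop :=
  Ideal.span (Set.range a) = I ∧
    ∀ (m' : ℕ) (b : Fin m' → MvPowerSeries (Fin s) K), Ideal.span (Set.range b) = I → m ≤ m'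

/-- `mng I`: the minimal number of generators of the ideal `I`. -/
def mng {s : ℕ} {K : Type*} [Field K] (I : Ideal (MvPowerSeries (Fin s) K)) : ℕ :=
  sInf { m : ℕ | ∃ a : Fin m → MvPowerSeries (Fin s) K, Ideal.span (Set.range a) = I }

/-- An ideal `I` is contact `k`-determined if for every (equivalently, some) minimal
set of generators `a_1,…,a_m` of `I`, every ideal `J` generated by elements
`b_1,…,b_m` with `b_i − a_i ∈ 𝔪^{k+1}` is contact equivalent to `I`. -/
def ContactDetermined {s : ℕ} {K : Type*} [Field K] (k : ℕ)
    (I : Ideal (MvPowerSeries (Fin s) K)) : Prop :=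
  ∀ (m : ℕ) (a : Fin m → MvPowerSeries (Fin s) K), IsMinGenSys a I →
    ∀ b : Fin m → MvPowerSeries (Fin s) K, (∀ i, b i - a i ∈ (mIdeal s K) ^ (k + 1)) →
      ContactEquiv I (Ideal.span (Set.range b))

/-- An ideal is finitely contact determined if it is contact `k`-determined for
some `k`. -/
def FinitelyContactDetermined {s : ℕ} {K : Type*} [Field K]
    (I : Ideal (MvPowerSeries (Fin s) K)) : Prop :=
  ∃ k : ℕ, ContactDetermined k I

end

theorem aux_lin {K : Type*} [Field K] {V : Type*} [AddCommGroup V] [Module K V] [FiniteDimensional K V]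
    (P E : V →ₗ[K] V) (h : ∀ v, P v = 0 → E v = v) : ∃ C : V →ₗ[K] V, Function.Injective (P + C ∘ₗ E) := by
  obtain ⟨Z, hZ⟩ := Submodule.exists_isCompl (LinearMap.ker P)
  obtain ⟨W, hW⟩ := Submodule.exists_isCompl (LinearMap.range P)
  have hd : Module.finrank K (LinearMap.ker P) = Module.finrank K W := by
    have h1 := LinearMap.finrank_range_add_finrank_ker P
    have h2 := Submodule.finrank_add_eq_of_isCompl hW
    omega
  let θ := LinearEquiv.ofFinrankEq _ _ hd
  refine ⟨W.subtype ∘ₗ θ.toLinearMap ∘ₗ (LinearMap.ker P).projectionOnto Z hZ, ?_⟩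
  rw [injective_iff_map_eq_zero]
  intro v hv
  simp only [LinearMap.add_apply, LinearMap.comp_apply] at hv
  have h1 : P v = 0 := by
    refine (Submodule.disjoint_def.1 hW.disjoint) _ ⟨v, rfl⟩ ?_
    rw [add_eq_zero_iff_eq_neg] at hv
    rw [hv]
    exact W.neg_mem (Subtype.property _)
  rw [h1, h v h1, zero_add] at hv
  have h2 := Submodule.projectionOnto_apply_left hZ ⟨v, h1⟩
  simp only at h2
  rw [h2] at hv
  have h3 : (⟨v, h1⟩ : LinearMap.ker P) = 0 := by simpa using hv
  exact congrArg Subtype.val h3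

theorem aux_mat {K : Type*} [Field K] {m : ℕ} (P Q : Matrix (Fin m) (Fin m) K) :
    ∃ C : Matrix (Fin m) (Fin m) K, IsUnit (P + C * (1 - Q * P)) := by
  obtain ⟨C, hC⟩ := aux_lin (Matrix.toLin' P) (Matrix.toLin' (1 - Q * P)) (by
    intro v hv
    simp only [Matrix.toLin'_apply] at hv
    simp [Matrix.sub_mulVec, ← Matrix.mulVec_mulVec, hv])
  refine ⟨LinearMap.toMatrix' C, ?_⟩
  rw [← Matrix.mulVec_injective_iff_isUnit]
  convert hC using 1
  ext v i
  rw [Matrix.add_mulVec, ← Matrix.mulVec_mulVec, LinearMap.toMatrix'_mulVec]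
  rfl

section aux

open MvPowerSeries

theorem mem_mIdeal_of_constantCoeff {s : ℕ} {K : Type*} [Field K] (f : MvPowerSeries (Fin s) K)
    (hf : constantCoeff f = 0) : f ∈ mIdeal s K := by
  classical
  let g : Fin s → MvPowerSeries (Fin s) K := fun j d =>
    if ∀ i < j, d i = 0 then coeff (d + Finsupp.single j 1) f else 0
  have : f = ∑ j, g j * X j := by
    ext e
    rw [map_sum]
    have key : ∀ j, coeff e (g j * X j) =
        if e j ≠ 0 ∧ ∀ i < j, e i = 0 then coeff e f else 0 := by
      intro j
      rw [X, coeff_mul_monomial]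
      by_cases hj : e j = 0
      · rw [if_neg, if_neg]
        · simp [hj]
        · simp [hj]
      · have hle : Finsupp.single j 1 ≤ e := by
          rw [Finsupp.single_le_iff]; omega
        rw [if_pos hle, mul_one]
        change (if _ then _ else _) = _
        rw [tsub_add_cancel_of_le hle]
        refine if_congr ?_ rfl rfl
        simp only [ne_eq, hj, not_false_eq_true, true_and]
        refine forall₂_congr fun i hi => ?_
        simp [Finsupp.single_apply, hi.ne']
    simp_rw [key]
    by_cases he : e = 0
    · subst he; simpa using hf
    · have hne : e.support.Nonempty := by simpa using he
      have hmin := Finset.min'_mem _ hne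
      rw [Finset.sum_eq_single (e.support.min' hne), if_pos]
      · refine ⟨by simpa using hmin, fun i hi => ?_⟩
        by_contra h
        exact absurd (Finset.min'_le _ i (by simpa using h)) (not_le.2 hi)
      · intro j _ hj
        rw [if_neg]
        rintro ⟨h1, h2⟩
        rcases lt_or_gt_of_ne hj with h | h
        · exact absurd (Finset.min'_le _ j (by simpa using h1)) (not_le.2 h)
        · exact absurd (h2 _ h) (by simpa using hmin)
      · simp
  rw [this]
  exact Ideal.sum_mem _ fun j _ => Ideal.mul_mem_left _ _ (Ideal.subset_span ⟨j, rfl⟩)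

section main

variable {s : ℕ} {K : Type*} [Field K]

theorem mem_mIdeal_iff (f : MvPowerSeries (Fin s) K) : f ∈ mIdeal s K ↔ constantCoeff f = 0 := by
  refine ⟨fun h => ?_, mem_mIdeal_of_constantCoeff f⟩
  have : mIdeal s K ≤ RingHom.ker (constantCoeff (σ := Fin s) (R := K)) := by
    rw [mIdeal, Ideal.span_le]
    rintro _ ⟨i, rfl⟩
    simp [RingHom.mem_ker]
  exact this h

theorem mIdeal_eq : mIdeal s K = IsLocalRing.maximalIdeal (MvPowerSeries (Fin s) K) := by
  ext f
  rw [mem_mIdeal_iff, IsLocalRing.mem_maximalIdeal, mem_nonunits_iff,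
    MvPowerSeries.isUnit_iff_constantCoeff, isUnit_iff_ne_zero, not_not]

theorem sub_C_mem (f : MvPowerSeries (Fin s) K) : f - C (constantCoeff f) ∈ mIdeal s K := by
  rw [mem_mIdeal_iff]; simp

theorem exists_poly (n : ℕ) (f : MvPowerSeries (Fin s) K) :
    ∃ p : MvPolynomial (Fin s) K, f - (p : MvPowerSeries (Fin s) K) ∈ mIdeal s K ^ n := by
  induction n generalizing f with
  | zero => exact ⟨0, by simp⟩
  | succ n ih =>
    have h := sub_C_mem f
    rw [mIdeal, Ideal.mem_span_range_iff_exists_fun] at h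
    obtain ⟨g, hg⟩ := h
    choose p hp using fun i => ih (g i)
    refine ⟨MvPolynomial.C (constantCoeff f) + ∑ i, p i * MvPolynomial.X i, ?_⟩
    have e : f - ((MvPolynomial.C (constantCoeff f) + ∑ i, p i * MvPolynomial.X i :
        MvPolynomial (Fin s) K) : MvPowerSeries (Fin s) K) =
        ∑ i, (g i - (p i : MvPowerSeries (Fin s) K)) * X i := by
      have hs : ((∑ i, p i * MvPolynomial.X i : MvPolynomial (Fin s) K) :
          MvPowerSeries (Fin s) K) = ∑ i, (p i : MvPowerSeries (Fin s) K) * X i := by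
        rw [← MvPolynomial.coeToMvPowerSeries.ringHom_apply, map_sum]
        simp
      rw [MvPolynomial.coe_add, hs, MvPolynomial.coe_C, ← sub_sub, ← hg, ← Finset.sum_sub_distrib]
      simp [sub_mul]
    rw [e, pow_succ]
    exact Ideal.sum_mem _ fun i _ => Ideal.mul_mem_mul (hp i) (Ideal.subset_span ⟨i, rfl⟩)

theorem algHom_ext_X {S : Type*} [CommRing S] [Algebra K S] [IsLocalRing S] [IsNoetherianRing S]
    (α β : MvPowerSeries (Fin s) K →ₐ[K] S) (h : ∀ i, α (X i) = β (X i))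
    (hα : ∀ i, α (X i) ∈ IsLocalRing.maximalIdeal S) : α = β := by
  have hmap : ∀ γ : MvPowerSeries (Fin s) K →ₐ[K] S,
      (∀ i, γ (X i) ∈ IsLocalRing.maximalIdeal S) → ∀ n, ∀ r ∈ mIdeal s K ^ n,
      γ r ∈ IsLocalRing.maximalIdeal S ^ n := by
    intro γ hγ n r hr
    have h1 : (mIdeal s K).map γ ≤ IsLocalRing.maximalIdeal S := by
      rw [mIdeal, Ideal.map_span, Ideal.span_le]
      rintro _ ⟨_, ⟨i, rfl⟩, rfl⟩
      exact hγ i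
    have h2 := Ideal.mem_map_of_mem γ hr
    rw [Ideal.map_pow] at h2
    exact Ideal.pow_right_mono h1 n h2
  have hpoly : ∀ p : MvPolynomial (Fin s) K, α (p : MvPowerSeries (Fin s) K) = β p := by
    intro p
    have : α.comp (MvPolynomial.coeToMvPowerSeries.algHom K) =
        β.comp (MvPolynomial.coeToMvPowerSeries.algHom K) := by
      apply MvPolynomial.algHom_ext
      intro i
      simpa using h i
    simpa using DFunLike.congr_fun this p
  ext f
  rw [← sub_eq_zero]
  have hb := Ideal.iInf_pow_eq_bot_of_isLocalRing (IsLocalRing.maximalIdeal S)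
    (IsLocalRing.maximalIdeal.isMaximal S).ne_top
  rw [← Ideal.mem_bot, ← hb, Ideal.mem_iInf]
  intro n
  obtain ⟨p, hp⟩ := exists_poly n f
  have e : α f - β f = α (f - p) - β (f - p) := by
    rw [map_sub, map_sub, hpoly]; ring
  rw [e]
  exact Ideal.sub_mem _ (hmap α hα n _ hp) (hmap β (fun i => h i ▸ hα i) n _ hp)

theorem exists_lin (f : MvPowerSeries (Fin s) K) (hf : f ∈ mIdeal s K) :
    ∃ v : Fin s → K, f - ∑ j, C (v j) * X j ∈ mIdeal s K ^ 2 := by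
  rw [mIdeal, Ideal.mem_span_range_iff_exists_fun] at hf
  obtain ⟨g, rfl⟩ := hf
  refine ⟨fun j => constantCoeff (g j), ?_⟩
  rw [← Finset.sum_sub_distrib, pow_two]
  refine Ideal.sum_mem _ fun i _ => ?_
  rw [← sub_mul]
  exact Ideal.mul_mem_mul (sub_C_mem _) (Ideal.subset_span ⟨i, rfl⟩)

theorem injective_of_surjective_ringHom {A : Type*} [CommRing A] [IsNoetherianRing A]
    (φ : A →+* A) (h : Function.Surjective φ) : Function.Injective φ := by
  have hinj := Ideal.comap_injective_of_surjective φ h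
  let a : ℕ →o Ideal A := ⟨fun n => (Ideal.comap φ)^[n] ⊥, by
    apply monotone_nat_of_le_succ
    intro n
    rw [Function.iterate_succ_apply]
    exact (show Monotone (Ideal.comap φ) from fun _ _ h => Ideal.comap_mono h).iterate n bot_le⟩
  obtain ⟨n, hn⟩ := monotone_stabilizes_iff_noetherian.2 (inferInstance : IsNoetherian A A) a
  have h1 : (Ideal.comap φ)^[n] ⊥ = (Ideal.comap φ)^[n] (Ideal.comap φ ⊥) := by
    rw [← Function.iterate_succ_apply]
    exact hn (n + 1) (Nat.le_succ n)
  have h2 := hinj.iterate n h1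
  rw [RingHom.injective_iff_ker_eq_bot]
  exact h2.symm

theorem bijective_of_lin (φ : MvPowerSeries (Fin s) K →ₐ[K] MvPowerSeries (Fin s) K)
    (hm : ∀ i, φ (X i) ∈ mIdeal s K)
    (M : Matrix (Fin s) (Fin s) K) (hM : IsUnit M)
    (h : ∀ i, φ (X i) - ∑ j, C (M i j) * X j ∈ mIdeal s K ^ 2) : Function.Bijective φ := by
  obtain ⟨N, hN⟩ := hM.exists_left_inv
  have hspan : (mIdeal s K).map φ = mIdeal s K := by
    apply le_antisymm
    · rw [mIdeal, Ideal.map_span, Ideal.span_le]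
      rintro _ ⟨_, ⟨i, rfl⟩, rfl⟩
      exact hm i
    · refine Submodule.le_of_le_smul_of_le_jacobson_bot (I := mIdeal s K)
        (IsNoetherian.noetherian _) ?_ ?_
      · rw [mIdeal_eq, IsLocalRing.jacobson_eq_maximalIdeal _ bot_ne_top]
      · nth_rewrite 1 [mIdeal]
        rw [Ideal.span_le]
        rintro _ ⟨k, rfl⟩
        have e : (X k : MvPowerSeries (Fin s) K) = ∑ i, C (N k i) * φ (X i) -
            ∑ i, C (N k i) * (φ (X i) - ∑ j, C (M i j) * X j) := by
          rw [← Finset.sum_sub_distrib]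
          simp_rw [← mul_sub, sub_sub_cancel, Finset.mul_sum, ← mul_assoc, ← map_mul]
          rw [Finset.sum_comm]
          simp_rw [← Finset.sum_mul, ← map_sum, ← Matrix.mul_apply, hN, Matrix.one_apply]
          simp
        rw [e]
        refine Submodule.sub_mem _ (Submodule.mem_sup_left ?_) (Submodule.mem_sup_right ?_)
        · exact Ideal.sum_mem _ fun i _ => Ideal.mul_mem_left _ _
            (Ideal.mem_map_of_mem _ (Ideal.subset_span ⟨i, rfl⟩))
        · rw [smul_eq_mul, ← pow_two]
          exact Ideal.sum_mem _ fun i _ => Ideal.mul_mem_left _ _ (h i)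
  have hc : IsAdicComplete (mIdeal s K) (MvPowerSeries (Fin s) K) := by
    unfold mIdeal; infer_instance
  have hspan' : (mIdeal s K).map (φ : MvPowerSeries (Fin s) K →+* MvPowerSeries (Fin s) K)
    = mIdeal s K := hspan
  have hs : Function.Surjective (φ : MvPowerSeries (Fin s) K →+* MvPowerSeries (Fin s) K) := by
    have : IsHausdorff ((mIdeal s K).map
      (φ : MvPowerSeries (Fin s) K →+* MvPowerSeries (Fin s) K)) (MvPowerSeries (Fin s) K) := by
      rw [hspan']; infer_instance
    apply surjective_of_mk_map_comp_surjective (I := mIdeal s K)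
    intro q
    obtain ⟨f, rfl⟩ := Ideal.Quotient.mk_surjective q
    refine ⟨C (constantCoeff f), ?_⟩
    rw [RingHom.comp_apply, Ideal.Quotient.mk_eq_mk_iff_sub_mem, hspan']
    have : φ (C (constantCoeff f)) = C (constantCoeff f) := φ.commutes (constantCoeff f)
    rw [RingHom.coe_coe, this, ← Ideal.neg_mem_iff, neg_sub]
    exact sub_C_mem f
  exact ⟨injective_of_surjective_ringHom _ hs, hs⟩

theorem exists_lift {I J : Ideal (MvPowerSeries (Fin s) K)} (hJ : J ≠ ⊤)
    (ψ : (MvPowerSeries (Fin s) K ⧸ I) →ₐ[K] (MvPowerSeries (Fin s) K ⧸ J))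
    (y : Fin s → MvPowerSeries (Fin s) K) (hy : ∀ i, y i ∈ mIdeal s K)
    (hψ : ∀ i, Ideal.Quotient.mk J (y i) = ψ (Ideal.Quotient.mk I (X i))) :
    ∃ φ : MvPowerSeries (Fin s) K →ₐ[K] MvPowerSeries (Fin s) K,
      (∀ i, φ (X i) = y i) ∧
      ∀ f, Ideal.Quotient.mk J (φ f) = ψ (Ideal.Quotient.mk I f) := by
  have hs : HasSubst y := hasSubst_of_constantCoeff_zero fun i => (mem_mIdeal_iff _).1 (hy i)
  have hX : ∀ i, substAlgHom (R := K) hs (X i) = y i := fun i => substAlgHom_X hs i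
  refine ⟨substAlgHom hs, hX, ?_⟩
  have : Nontrivial (MvPowerSeries (Fin s) K ⧸ J) := Ideal.Quotient.nontrivial_iff.2 hJ
  have : IsLocalRing (MvPowerSeries (Fin s) K ⧸ J) :=
    IsLocalRing.of_surjective' (Ideal.Quotient.mk J) Ideal.Quotient.mk_surjective
  have := algHom_ext_X ((Ideal.Quotient.mkₐ K J).comp (substAlgHom hs))
    (ψ.comp (Ideal.Quotient.mkₐ K I)) (fun i => by
      rw [AlgHom.comp_apply, hX]; exact hψ i) (fun i => by
      rw [AlgHom.comp_apply, hX, IsLocalRing.mem_maximalIdeal, mem_nonunits_iff]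
      intro hu
      have h1 := hy i
      rw [mIdeal_eq] at h1
      have : IsLocalHom (Ideal.Quotient.mk J) :=
        IsLocalHom.of_surjective _ Ideal.Quotient.mk_surjective
      exact h1 (isUnit_of_map_unit (Ideal.Quotient.mk J) _ hu))
  intro f
  exact DFunLike.congr_fun this f

theorem exists_y {I J : Ideal (MvPowerSeries (Fin s) K)} (hI : I ≠ ⊤)
    (ψ : (MvPowerSeries (Fin s) K ⧸ I) ≃ₐ[K] (MvPowerSeries (Fin s) K ⧸ J)) :
    ∃ y : Fin s → MvPowerSeries (Fin s) K, (∀ i, y i ∈ mIdeal s K) ∧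
     ∀ i, Ideal.Quotient.mk J (y i) = ψ (Ideal.Quotient.mk I (X i)) := by
  choose y hy using fun i => Ideal.Quotient.mk_surjective (ψ (Ideal.Quotient.mk I (X i)))
  refine ⟨y, fun i => ?_, hy⟩
  rw [mIdeal_eq, IsLocalRing.mem_maximalIdeal, mem_nonunits_iff]
  intro hu
  have h1 := hu.map (Ideal.Quotient.mk J)
  rw [hy i] at h1
  have h2 : IsUnit (Ideal.Quotient.mk I (X i)) := (MulEquiv.isUnit_map ψ).1 h1
  have : Nontrivial (MvPowerSeries (Fin s) K ⧸ I) := Ideal.Quotient.nontrivial_iff.2 hI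
  have : IsLocalHom (Ideal.Quotient.mk I) :=
        IsLocalHom.of_surjective _ Ideal.Quotient.mk_surjective
  have h3 := isUnit_of_map_unit (Ideal.Quotient.mk I) _ h2
  rw [MvPowerSeries.isUnit_iff_constantCoeff] at h3
  simp at h3

theorem contact_lift {I J : Ideal (MvPowerSeries (Fin s) K)} (hI : I ≠ ⊤) (hJ : J ≠ ⊤)
    (h : ContactEquiv I J) :
    ∃ φ : MvPowerSeries (Fin s) K ≃ₐ[K] MvPowerSeries (Fin s) K, Ideal.map φ I = J := by
  obtain ⟨ψ⟩ := h
  obtain ⟨y, hy, hyψ⟩ := exists_y hI ψ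
  obtain ⟨z, hz, hzψ⟩ := exists_y hJ ψ.symm
  obtain ⟨φ, hφX, hφ⟩ := exists_lift hJ ψ.toAlgHom y hy hyψ
  choose P hP using fun i => exists_lin (y i) (hy i)
  choose Q hQ using fun i => exists_lin (z i) (hz i)
  obtain ⟨D, hD⟩ := aux_mat (Matrix.of P) (Matrix.of Q)
  have hφm : (mIdeal s K).map φ ≤ mIdeal s K := by
    rw [mIdeal, Ideal.map_span, Ideal.span_le]
    rintro _ ⟨_, ⟨i, rfl⟩, rfl⟩
    rw [hφX]; exact hy i
  have hφm2 : ∀ f ∈ mIdeal s K ^ 2, φ f ∈ mIdeal s K ^ 2 := by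
    intro f hf
    have h2 := Ideal.mem_map_of_mem φ hf
    rw [Ideal.map_pow] at h2
    exact Ideal.pow_right_mono hφm 2 h2
  have hφC : ∀ c : K, φ (C c) = C c := fun c => φ.commutes c
  have hφz : ∀ k, φ (z k) - ∑ j, C ((Matrix.of Q * Matrix.of P) k j) * X j ∈ mIdeal s K ^ 2 := by
    intro k
    have h1 := hφm2 _ (hQ k)
    have h2 : ∑ i, C (Q k i) * (y i - ∑ j, C (P i j) * X j) ∈ mIdeal s K ^ 2 :=
      Ideal.sum_mem _ fun i _ => Ideal.mul_mem_left _ _ (hP i)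
    convert Ideal.add_mem _ h1 h2 using 1
    simp only [map_sub, map_sum, map_mul, hφC, hφX, mul_sub, Finset.sum_sub_distrib]
    rw [sub_add_sub_cancel]
    congr 1
    simp_rw [Matrix.mul_apply, map_sum, Finset.sum_mul, Finset.mul_sum, map_mul, Matrix.of_apply,
      mul_assoc]
    exact Finset.sum_comm
  let w : Fin s → MvPowerSeries (Fin s) K := fun i => y i + ∑ k, C (D i k) * (X k - φ (z k))
  have hXm : ∀ k, (X k : MvPowerSeries (Fin s) K) ∈ mIdeal s K :=
    fun k => Ideal.subset_span ⟨k, rfl⟩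
  have hw : ∀ i, w i ∈ mIdeal s K := fun i => Ideal.add_mem _ (hy i) <|
    Ideal.sum_mem _ fun k _ => Ideal.mul_mem_left _ _ <|
      Ideal.sub_mem _ (hXm k) (hφm (Ideal.mem_map_of_mem _ (hz k)))
  have hwψ : ∀ i, Ideal.Quotient.mk J (w i) = ψ (Ideal.Quotient.mk I (X i)) := by
    intro i
    rw [← hyψ i, Ideal.Quotient.mk_eq_mk_iff_sub_mem, add_sub_cancel_left]
    refine Ideal.sum_mem _ fun k _ => Ideal.mul_mem_left _ _ ?_
    rw [← Ideal.Quotient.mk_eq_mk_iff_sub_mem, hφ, hzψ]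
    simp
  obtain ⟨θ, hθX, hθ⟩ := exists_lift hJ ψ.toAlgHom w hw hwψ
  have hbij : Function.Bijective θ := by
    refine bijective_of_lin θ (fun i => by rw [hθX]; exact hw i) _ hD fun i => ?_
    rw [hθX]
    have h2 : ∑ k, C (D i k) * (φ (z k) - ∑ j, C ((Matrix.of Q * Matrix.of P) k j) * X j)
        ∈ mIdeal s K ^ 2 :=
      Ideal.sum_mem _ fun k _ => Ideal.mul_mem_left _ _ (hφz k)
    convert Ideal.sub_mem _ (hP i) h2 using 1
    simp only [w]
    have e : ∑ j, C ((Matrix.of P + D * (1 - Matrix.of Q * Matrix.of P)) i j) *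
        (X j : MvPowerSeries (Fin s) K) = ∑ j, C (P i j) * X j + ∑ k, C (D i k) * X k -
        ∑ k, C (D i k) * ∑ j, C ((Matrix.of Q * Matrix.of P) k j) * X j := by
      rw [mul_sub, mul_one]
      simp only [Matrix.add_apply, Matrix.sub_apply, Matrix.of_apply, map_add, map_sub, add_mul,
        sub_mul, Finset.sum_add_distrib, Finset.sum_sub_distrib]
      rw [add_sub_assoc]
      congr 2
      simp_rw [Matrix.mul_apply (M := D), map_sum, Finset.sum_mul, Finset.mul_sum, map_mul,
        mul_assoc]
      exact Finset.sum_comm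
    rw [e]
    simp only [mul_sub, Finset.sum_sub_distrib]
    ring
  refine ⟨AlgEquiv.ofBijective θ hbij, ?_⟩
  have hmem : ∀ f, θ f ∈ J ↔ f ∈ I := by
    intro f
    rw [← Ideal.Quotient.eq_zero_iff_mem, hθ, ← Ideal.Quotient.eq_zero_iff_mem]
    exact map_eq_zero_iff ψ ψ.injective
  ext g
  obtain ⟨f, rfl⟩ := hbij.2 g
  rw [hmem]
  constructor
  · intro hf
    obtain ⟨f', hf', e⟩ := (Ideal.mem_map_iff_of_surjective _
      (AlgEquiv.ofBijective θ hbij).surjective).1 hf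
    rwa [← hbij.1 e]
  · intro hf
    exact Ideal.mem_map_of_mem (AlgEquiv.ofBijective θ hbij) hf

theorem isUnit_matrix_iff {m : ℕ} (U : Matrix (Fin m) (Fin m) (MvPowerSeries (Fin s) K)) :
    IsUnit U ↔ IsUnit (U.map (constantCoeff (σ := Fin s) (R := K))) := by
  rw [Matrix.isUnit_iff_isUnit_det, Matrix.isUnit_iff_isUnit_det,
    MvPowerSeries.isUnit_iff_constantCoeff, RingHom.map_det]
  rfl

theorem exists_unit_of_span_eq {m : ℕ} (a b : Fin m → MvPowerSeries (Fin s) K)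
    (h : Ideal.span (Set.range a) = Ideal.span (Set.range b)) :
    ∃ U : Matrix (Fin m) (Fin m) (MvPowerSeries (Fin s) K), IsUnit U ∧ b = U.mulVec a := by
  have h1 : ∀ i, ∃ c : Fin m → MvPowerSeries (Fin s) K, ∑ j, c j * a j = b i := fun i => by
    rw [← Ideal.mem_span_range_iff_exists_fun, h]; exact Ideal.subset_span ⟨i, rfl⟩
  have h2 : ∀ i, ∃ c : Fin m → MvPowerSeries (Fin s) K, ∑ j, c j * b j = a i := fun i => by
    rw [← Ideal.mem_span_range_iff_exists_fun, ← h]; exact Ideal.subset_span ⟨i, rfl⟩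
  choose P hP using h1
  choose Q hQ using h2
  have hP' : (Matrix.of P).mulVec a = b := funext hP
  have hQ' : (Matrix.of Q).mulVec b = a := funext hQ
  obtain ⟨D, hD⟩ := aux_mat ((Matrix.of P).map (constantCoeff (σ := Fin s) (R := K)))
    ((Matrix.of Q).map (constantCoeff (σ := Fin s) (R := K)))
  refine ⟨Matrix.of P + D.map C * (1 - Matrix.of Q * Matrix.of P), ?_, ?_⟩
  · rw [isUnit_matrix_iff]
    convert hD using 1
    have hDC : (D.map C).map (constantCoeff (σ := Fin s) (R := K)) = D := by
      ext i j; simp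
    rw [Matrix.map_add _ (map_add _), Matrix.map_mul, Matrix.map_sub _ (map_sub _),
      Matrix.map_mul, hDC, Matrix.map_one _ (map_zero _) (map_one _)]
  · rw [Matrix.add_mulVec, ← Matrix.mulVec_mulVec, Matrix.sub_mulVec, ← Matrix.mulVec_mulVec,
      hP', hQ', Matrix.one_mulVec, sub_self, Matrix.mulVec_zero, add_zero]

theorem span_mulVec_le {m : ℕ} (a : Fin m → MvPowerSeries (Fin s) K)
    (U : Matrix (Fin m) (Fin m) (MvPowerSeries (Fin s) K)) :
    Ideal.span (Set.range (U.mulVec a)) ≤ Ideal.span (Set.range a) := by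
  rw [Ideal.span_le]
  rintro _ ⟨i, rfl⟩
  change ∑ j, U i j * a j ∈ Ideal.span (Set.range a)
  exact Ideal.sum_mem _ fun j _ => Ideal.mul_mem_left _ _ (Ideal.subset_span (Set.mem_range_self j))

theorem span_mulVec_eq {m : ℕ} (a : Fin m → MvPowerSeries (Fin s) K)
    (U : Matrix (Fin m) (Fin m) (MvPowerSeries (Fin s) K)) (hU : IsUnit U) :
    Ideal.span (Set.range (U.mulVec a)) = Ideal.span (Set.range a) := by
  refine le_antisymm (span_mulVec_le a U) ?_
  obtain ⟨N, hN⟩ := hU.exists_left_inv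
  have := span_mulVec_le (U.mulVec a) N
  rwa [Matrix.mulVec_mulVec, hN, Matrix.one_mulVec] at this

theorem map_span_range {m : ℕ} (a : Fin m → MvPowerSeries (Fin s) K)
    (φ : MvPowerSeries (Fin s) K ≃ₐ[K] MvPowerSeries (Fin s) K) :
    Ideal.map φ (Ideal.span (Set.range a)) = Ideal.span (Set.range fun i => φ (a i)) := by
  rw [Ideal.map_span, ← Set.range_comp]; rfl

theorem contact_iff_map {I J : Ideal (MvPowerSeries (Fin s) K)} (hI : I ≠ ⊤) (hJ : J ≠ ⊤) :
    ContactEquiv I J ↔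
    ∃ φ : MvPowerSeries (Fin s) K ≃ₐ[K] MvPowerSeries (Fin s) K, Ideal.map φ I = J :=
  ⟨contact_lift hI hJ, fun ⟨φ, h⟩ => Nonempty.intro (Ideal.quotientEquivAlg I J φ h.symm)⟩

theorem map_iff_mat {m : ℕ} (a b : Fin m → MvPowerSeries (Fin s) K) :
    (∃ φ : MvPowerSeries (Fin s) K ≃ₐ[K] MvPowerSeries (Fin s) K,
        Ideal.map φ (Ideal.span (Set.range a)) = Ideal.span (Set.range b)) ↔
      ∃ (φ : MvPowerSeries (Fin s) K ≃ₐ[K] MvPowerSeries (Fin s) K)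
        (U : Matrix (Fin m) (Fin m) (MvPowerSeries (Fin s) K)), IsUnit U ∧
          (Matrix.of fun (i : Fin m) (_ : Fin 1) => b i) =
            U * (Matrix.of fun (i : Fin m) (_ : Fin 1) => a i).map φ := by
  refine exists_congr fun φ => ?_
  rw [map_span_range]
  constructor
  · intro h
    obtain ⟨U, hU, e⟩ := exists_unit_of_span_eq _ _ h
    refine ⟨U, hU, ?_⟩
    ext1 i j
    exact congrFun e i
  · rintro ⟨U, hU, e⟩
    rw [← span_mulVec_eq _ U hU]
    congr 2
    ext1 i
    exact (congrFun (congrFun e i) 0).symm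

theorem mat_iff_GEquiv {m : ℕ} (a b : Fin m → MvPowerSeries (Fin s) K) :
      (∃ (φ : MvPowerSeries (Fin s) K ≃ₐ[K] MvPowerSeries (Fin s) K)
        (U : Matrix (Fin m) (Fin m) (MvPowerSeries (Fin s) K)), IsUnit U ∧
          (Matrix.of fun (i : Fin m) (_ : Fin 1) => b i) =
            U * (Matrix.of fun (i : Fin m) (_ : Fin 1) => a i).map φ) ↔
      GEquiv (Matrix.of fun (i : Fin m) (_ : Fin 1) => a i)
        (Matrix.of fun (i : Fin m) (_ : Fin 1) => b i) := by
  constructor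
  · rintro ⟨φ, U, hU, e⟩
    exact ⟨U, 1, φ, hU, isUnit_one, by rw [Matrix.mul_one]; exact e⟩
  · rintro ⟨U, V, φ, hU, hV, e⟩
    have hv : IsUnit (V 0 0) := by
      rw [Matrix.isUnit_iff_isUnit_det, Matrix.det_fin_one] at hV; exact hV
    obtain ⟨v, hv⟩ := hv
    refine ⟨φ, v • U, hU.smul v, ?_⟩
    rw [e]
    ext1 i j
    rw [Matrix.smul_mul, Matrix.mul_apply]
    simp only [Fin.sum_univ_one, Fin.isValue, Subsingleton.elim j 0, ← hv, Matrix.smul_apply]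
    rw [Units.smul_def, smul_eq_mul, mul_comm]

theorem determined_iff {m : ℕ} (a : Fin m → MvPowerSeries (Fin s) K)
    (hI : Ideal.span (Set.range a) ≠ ⊤) (hm : mng (Ideal.span (Set.range a)) = m) (k : ℕ) :
    ContactDetermined k (Ideal.span (Set.range a)) ↔
        GDetermined k (Matrix.of fun (i : Fin m) (_ : Fin 1) => a i) := by
  have hmin : IsMinGenSys a (Ideal.span (Set.range a)) := by
    refine ⟨rfl, fun m' b hb => ?_⟩
    rw [← hm]
    exact Nat.sInf_le ⟨b, hb⟩
  have proper : ∀ b : Fin m → MvPowerSeries (Fin s) K,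
      (∀ i, b i - a i ∈ mIdeal s K ^ (k + 1)) → Ideal.span (Set.range b) ≠ ⊤ := by
    intro b hb htop
    have ha : Ideal.span (Set.range a) ≤ mIdeal s K := by
      rw [mIdeal_eq]; exact IsLocalRing.le_maximalIdeal hI
    have hle : Ideal.span (Set.range b) ≤ mIdeal s K := by
      rw [Ideal.span_le]
      rintro _ ⟨i, rfl⟩
      have := Ideal.add_mem _ (Ideal.pow_le_self (Nat.succ_ne_zero k) (hb i))
        (ha (Ideal.subset_span ⟨i, rfl⟩))
      rwa [sub_add_cancel] at this
    rw [htop, mIdeal_eq, top_le_iff] at hle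
    exact (IsLocalRing.maximalIdeal.isMaximal _).ne_top hle
  constructor
  · intro h B hB
    have hb : ∀ i, B i 0 - a i ∈ mIdeal s K ^ (k + 1) := fun i => hB i 0
    have h1 := h m a hmin (fun i => B i 0) hb
    rw [contact_iff_map hI (proper _ hb), map_iff_mat, mat_iff_GEquiv] at h1
    convert h1 using 1
    ext1 i j
    rw [Subsingleton.elim j 0]; rfl
  · intro h m' a' ha' b' hb'
    obtain rfl : m' = m := le_antisymm (ha'.2 m a rfl) (hmin.2 m' a' ha'.1)
    obtain ⟨U, hU, e⟩ := exists_unit_of_span_eq a' a ha'.1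
    have hb : ∀ i, U.mulVec b' i - a i ∈ mIdeal s K ^ (k + 1) := by
      intro i
      have e2 : U.mulVec b' i - a i = ∑ j, U i j * (b' j - a' j) := by
        rw [congrFun e i]
        simp [Matrix.mulVec, dotProduct, mul_sub, Finset.sum_sub_distrib]
      rw [e2]
      exact Ideal.sum_mem _ fun j _ => Ideal.mul_mem_left _ _ (hb' j)
    have h1 := h (Matrix.of fun i _ => U.mulVec b' i) (fun i _ => hb i)
    rw [← mat_iff_GEquiv, ← map_iff_mat, ← contact_iff_map hI (proper _ hb),
      span_mulVec_eq _ U hU] at h1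
    exact h1

end main

end aux

/-- For proper ideals `I = ⟨a_1,…,a_m⟩` and `J = ⟨b_1,…,b_m⟩` of `R = K[[x_1,…,x_s]]`
with corresponding column matrices `A`, `B`, the following are equivalent:
(1) `I` and `J` are contact equivalent; (2) `φ(I) = J` for some `K`-algebra
automorphism `φ` of `R`; (3) `B = U·φ(A)` for some automorphism `φ` and
`U ∈ GL(m,R)`; (4) `A` and `B` are `G`-equivalent. Moreover, if `m = mng(I)`, then
`I` is contact `k`-determined iff `A` is `G` `k`-determined. -/
theorem contactEquiv_iff_GEquiv
    {s : ℕ} {K : Type*} [Field K] {m : ℕ}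
    (a b : Fin m → MvPowerSeries (Fin s) K)
    (hI : Ideal.span (Set.range a) ≠ ⊤) (hJ : Ideal.span (Set.range b) ≠ ⊤) :
    (ContactEquiv (Ideal.span (Set.range a)) (Ideal.span (Set.range b)) ↔
      ∃ φ : MvPowerSeries (Fin s) K ≃ₐ[K] MvPowerSeries (Fin s) K,
        Ideal.map φ (Ideal.span (Set.range a)) = Ideal.span (Set.range b)) ∧
    (ContactEquiv (Ideal.span (Set.range a)) (Ideal.span (Set.range b)) ↔
      ∃ (φ : MvPowerSeries (Fin s) K ≃ₐ[K] MvPowerSeries (Fin s) K)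
        (U : Matrix (Fin m) (Fin m) (MvPowerSeries (Fin s) K)), IsUnit U ∧
          (Matrix.of fun (i : Fin m) (_ : Fin 1) => b i) =
            U * (Matrix.of fun (i : Fin m) (_ : Fin 1) => a i).map φ) ∧
    (ContactEquiv (Ideal.span (Set.range a)) (Ideal.span (Set.range b)) ↔
      GEquiv (Matrix.of fun (i : Fin m) (_ : Fin 1) => a i)
        (Matrix.of fun (i : Fin m) (_ : Fin 1) => b i)) ∧
    (mng (Ideal.span (Set.range a)) = m →
      ∀ k : ℕ, (ContactDetermined k (Ideal.span (Set.range a)) ↔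
        GDetermined k (Matrix.of fun (i : Fin m) (_ : Fin 1) => a i))) := by
  refine ⟨contact_iff_map hI hJ, ?_, ?_, determined_iff a hI⟩
  · rw [contact_iff_map hI hJ, map_iff_mat]
  · rw [contact_iff_map hI hJ, map_iff_mat, mat_iff_GEquiv]
end

section
/- Let I be a proper ideal of R = K[[x_1,…,x_s]] with dim(R/I) = 0 (i.e., I contains a power of the maximal ideal 𝔪). Then I is finitely contact determined. -/
/-- A proper ideal `I` of `R = K[[x_1,…,x_s]]` with `dim(R/I) = 0` is finitely
contact determined. -/
theorem finitelyContactDetermined_of_dim_zero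
    {s : ℕ} {K : Type*} [Field K] (I : Ideal (MvPowerSeries (Fin s) K))
    (hI : I ≠ ⊤) (hdim : ringKrullDim (MvPowerSeries (Fin s) K ⧸ I) = 0) :
    FinitelyContactDetermined I := by
  have hloc : mIdeal s K ≤ IsLocalRing.maximalIdeal (MvPowerSeries (Fin s) K) := by
    rw [mIdeal, Ideal.span_le]
    rintro _ ⟨i, rfl⟩
    rw [SetLike.mem_coe, IsLocalRing.mem_maximalIdeal, mem_nonunits_iff,
      MvPowerSeries.isUnit_iff_constantCoeff]
    simp
  have hfg : (mIdeal s K).FG :=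
    ⟨(Set.finite_range (MvPowerSeries.X : Fin s → MvPowerSeries (Fin s) K)).toFinset,
      by simp [mIdeal]⟩
  have hrad : mIdeal s K ≤ I.radical := by
    rw [Ideal.radical_eq_sInf]
    refine le_sInf ?_
    rintro P ⟨hIP, hP⟩
    have : Ring.KrullDimLE 0 (MvPowerSeries (Fin s) K ⧸ I) := by
      rw [Ring.krullDimLE_iff, hdim]; simp
    have hP' : (P.map (Ideal.Quotient.mk I)).IsPrime :=
      Ideal.map_isPrime_of_surjective Ideal.Quotient.mk_surjective (by simpa using hIP)
    have hM : (P.map (Ideal.Quotient.mk I)).IsMaximal := Ideal.IsPrime.isMaximal' hP'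
    have hM2 := Ideal.comap_isMaximal_of_surjective (Ideal.Quotient.mk I)
      Ideal.Quotient.mk_surjective (K := P.map (Ideal.Quotient.mk I))
    rw [Ideal.comap_map_of_surjective _ Ideal.Quotient.mk_surjective, ← RingHom.ker_eq_comap_bot,
      Ideal.mk_ker, sup_eq_left.2 hIP] at hM2
    rw [IsLocalRing.eq_maximalIdeal hM2]
    exact hloc
  obtain ⟨N, hN⟩ := Ideal.exists_pow_le_of_le_radical_of_fg hrad hfg
  refine ⟨N, fun m a ha b hb => ?_⟩
  have hIfg : I.FG := ⟨(Set.finite_range a).toFinset, by simp [ha.1]⟩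
  have hba : ∀ i, b i - a i ∈ mIdeal s K * I := fun i =>
    Ideal.mul_mono_right hN (by rw [← pow_succ']; exact hb i)
  have haI : ∀ i, a i ∈ I := fun i => ha.1 ▸ Ideal.subset_span ⟨i, rfl⟩
  have hJI : Ideal.span (Set.range b) ≤ I := by
    rw [Ideal.span_le]
    rintro _ ⟨i, rfl⟩
    have h2 : b i - a i ∈ I := (Ideal.mul_le_right : mIdeal s K * I ≤ I) (hba i)
    have h3 := I.add_mem h2 (haI i)
    rw [sub_add_cancel] at h3
    exact h3
  have hIJ : I ≤ Ideal.span (Set.range b) := by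
    refine Submodule.le_of_le_smul_of_le_jacobson_bot (I := mIdeal s K) hIfg
      (hloc.trans (IsLocalRing.maximalIdeal_le_jacobson _)) ?_
    conv_lhs => rw [← ha.1]
    rw [Ideal.span_le]
    rintro _ ⟨i, rfl⟩
    have h1 : b i ∈ Ideal.span (Set.range b) := Ideal.subset_span ⟨i, rfl⟩
    have h2 := Submodule.sub_mem_sup h1 (hba i)
    rw [sub_sub_cancel] at h2
    exact h2
  rw [le_antisymm hJI hIJ]
  exact ⟨AlgEquiv.refl⟩
end
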